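/- Fix k ≥ 1, a metric space (Ω,d) with antipodes of diameter Δ, and a canonical potential Φ(w, u, X) = w(ū^k) + Σ_{i=1}^k w({u} ∪ X_i) − Σ_{{(i,j),(i',j')} ∈ Q} d(x_{i,j}, x_{i',j'}), where X = (x_{i,j}) with i ∈ {1,…,k}, j ∈ {1,…,k−1}, X_i = {x_{i,1},…,x_{i,k−1}}, and Q is a fixed set of unordered pairs of index pairs. For a k-server instance, define the potential values Φ_t = inf over X of Φ(w_t, r_t, X). Suppose that for every k-server instance on (Ω,d) and every applicable t, Φ_t − Φ_{t−1} ≥ w_t(r̄_t^k) − w_{t−1}(r̄_t^k), where r̄_t is the antipode of r_t. Then for every k-server instance on (Ω,d) and every t ≥ 1, Φ_t = inf over u ∈ Ω and X of Φ(w_t, u, X); i.e., restricting the first argument to the last request does not change the infimum. -/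

import Mathlib

open Finset

/-- Minimum-matching (Wasserstein) distance between two `k`-point configurations,
represented as `k`-tuples of points. -/
noncomputable def confDist {Ω : Type*} [MetricSpace Ω] {k : ℕ} (X Y : Fin k → Ω) : ℝ :=
  ⨅ σ : Equiv.Perm (Fin k), ∑ i, dist (X i) (Y (σ i))

/-- The work function at time `t` of the `k`-server instance with initial configuration
`X₀` and requests `r 1, r 2, …` (the value `r 0` is unused): the least cost of serving
the first `t` requests and then moving to the configuration `X`. -/
noncomputable def workFn {Ω : Type*} [MetricSpace Ω] (k : ℕ) (X₀ : Fin k → Ω)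
    (r : ℕ → Ω) (t : ℕ) (X : Fin k → Ω) : ℝ :=
  sInf { c : ℝ | ∃ Y : ℕ → Fin k → Ω, Y 0 = X₀ ∧
    (∀ i ∈ Finset.Icc 1 t, ∃ j, Y i j = r i) ∧
    c = (∑ i ∈ Finset.Icc 1 t, confDist (Y (i - 1)) (Y i)) + confDist (Y t) X }

/-- The offline optimum of the `k`-server instance with initial configuration `X₀`
and requests `r 1, …, r T`. -/
noncomputable def opt {Ω : Type*} [MetricSpace Ω] (k : ℕ) (X₀ : Fin k → Ω)
    (r : ℕ → Ω) (T : ℕ) : ℝ :=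
  sInf { c : ℝ | ∃ Y : ℕ → Fin k → Ω, Y 0 = X₀ ∧
    (∀ i ∈ Finset.Icc 1 T, ∃ j, Y i j = r i) ∧
    c = ∑ i ∈ Finset.Icc 1 T, confDist (Y (i - 1)) (Y i) }

/-- `OPT_t(Z)`: the least cost of serving the first `t` requests while ending
in the configuration `Z`. -/
noncomputable def optTo {Ω : Type*} [MetricSpace Ω] (k : ℕ) (X₀ : Fin k → Ω)
    (r : ℕ → Ω) (t : ℕ) (Z : Fin k → Ω) : ℝ :=
  sInf { c : ℝ | ∃ Y : ℕ → Fin k → Ω, Y 0 = X₀ ∧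
    (∀ i ∈ Finset.Icc 1 t, ∃ j, Y i j = r i) ∧ Y t = Z ∧
    c = ∑ i ∈ Finset.Icc 1 t, confDist (Y (i - 1)) (Y i) }

/-- `X 0, X 1, …, X T` is a run of the work function algorithm on the `k`-server
instance with initial configuration `X₀` and requests `r 1, …, r T`. -/
def IsWFARun {Ω : Type*} [MetricSpace Ω] (k : ℕ) (X₀ : Fin k → Ω)
    (r : ℕ → Ω) (T : ℕ) (X : ℕ → Fin k → Ω) : Prop :=
  X 0 = X₀ ∧ ∀ t, 1 ≤ t → t ≤ T →
    (∃ j, X t j = r t) ∧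
    ∀ Z : Fin k → Ω, (∃ j, Z j = r t) →
      optTo k X₀ r t (X t) + confDist (X t) (X (t - 1)) ≤
        optTo k X₀ r t Z + confDist Z (X (t - 1))

/-- The canonical potential `Φ(w,u,X) = w(ū^k) + Σ_i w({u} ∪ X_i) − Σ_{pairs ∈ Q} d(·,·)`
for `k = m+1` servers, where `X = (x_{i,j})` and `Q` is a set of unordered pairs of
index pairs. -/
noncomputable def canonPhi {Ω : Type*} [MetricSpace Ω] {m : ℕ} (bar : Ω → Ω)
    (Q : Finset (Sym2 (Fin (m + 1) × Fin m))) (w : (Fin (m + 1) → Ω) → ℝ)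
    (u : Ω) (x : Fin (m + 1) → Fin m → Ω) : ℝ :=
  w (fun _ => bar u) + (∑ i, w (Fin.cons u (x i))) -
    ∑ q ∈ Q, Sym2.lift
      ⟨fun a b => dist (x a.1 a.2) (x b.1 b.2), fun _ _ => dist_comm _ _⟩ q

section WorkFunction

variable {Ω : Type*} [MetricSpace Ω]

lemma confDist_nonneg {k : ℕ} (X Y : Fin k → Ω) : 0 ≤ confDist X Y :=
  Real.iInf_nonneg fun _ => Finset.sum_nonneg fun _ _ => dist_nonneg

lemma confDist_self {k : ℕ} (X : Fin k → Ω) : confDist X X = 0 := by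
  refine le_antisymm ?_ (confDist_nonneg X X)
  refine (ciInf_le (Set.finite_range _).bddBelow (1 : Equiv.Perm (Fin k))).trans ?_
  simp

lemma zero_mem_lowerBounds_workFn_costs (k : ℕ) (X₀ : Fin k → Ω) (r : ℕ → Ω) (t : ℕ)
    (X : Fin k → Ω) : (0 : ℝ) ∈ lowerBounds { c : ℝ | ∃ Y : ℕ → Fin k → Ω, Y 0 = X₀ ∧
      (∀ i ∈ Finset.Icc 1 t, ∃ j, Y i j = r i) ∧
      c = (∑ i ∈ Finset.Icc 1 t, confDist (Y (i - 1)) (Y i)) + confDist (Y t) X } := by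
  rintro c ⟨Y, -, -, rfl⟩
  exact add_nonneg (Finset.sum_nonneg fun _ _ => confDist_nonneg _ _) (confDist_nonneg _ _)

lemma workFn_nonneg (k : ℕ) (X₀ : Fin k → Ω) (r : ℕ → Ω) (t : ℕ) (X : Fin k → Ω) :
    0 ≤ workFn k X₀ r t X :=
  Real.sInf_nonneg fun _ hc => zero_mem_lowerBounds_workFn_costs k X₀ r t X hc

lemma workFn_congr (k : ℕ) (X₀ : Fin k → Ω) {r r' : ℕ → Ω} {t : ℕ}
    (h : ∀ i ∈ Finset.Icc 1 t, r i = r' i) : workFn k X₀ r t = workFn k X₀ r' t := by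
  funext X
  have key : ∀ Y : ℕ → Fin k → Ω, (∀ i ∈ Finset.Icc 1 t, ∃ j, Y i j = r i) ↔
      ∀ i ∈ Finset.Icc 1 t, ∃ j, Y i j = r' i := fun Y =>
    forall₂_congr fun i hi => by rw [h i hi]
  simp only [workFn, key]

/-- Serving a request does not increase the work function at configurations that
already contain the requested point. -/
lemma workFn_succ_le {m : ℕ} (X₀ : Fin (m + 1) → Ω) (r : ℕ → Ω) (t : ℕ)
    (X : Fin (m + 1) → Ω) (hX : ∃ j, X j = r (t + 1)) :
    workFn (m + 1) X₀ r (t + 1) X ≤ workFn (m + 1) X₀ r t X := by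
  refine le_csInf ⟨_, fun i => if i = 0 then X₀ else fun _ => r i, by simp, ?_, rfl⟩ ?_
  · intro i hi
    have : i ≠ 0 := by simp at hi; omega
    exact ⟨0, by simp [this]⟩
  · rintro c ⟨Y, hY0, hY, rfl⟩
    refine csInf_le ⟨0, zero_mem_lowerBounds_workFn_costs _ _ _ _ _⟩
      ⟨Function.update Y (t + 1) X, ?_, ?_, ?_⟩
    · rw [Function.update_of_ne (by omega), hY0]
    · intro i hi
      obtain ⟨h1, h2⟩ := Finset.mem_Icc.1 hi
      rcases eq_or_ne i (t + 1) with rfl | hne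
      · simpa using hX
      · rw [Function.update_of_ne hne]
        exact hY i (Finset.mem_Icc.2 ⟨h1, by omega⟩)
    · rw [Finset.sum_Icc_succ_top (by omega), Function.update_self, confDist_self, add_zero,
        Nat.add_sub_cancel, Function.update_of_ne (by omega)]
      congr 1
      refine Finset.sum_congr rfl fun i hi => ?_
      have := Finset.mem_Icc.1 hi
      rw [Function.update_of_ne (by omega), Function.update_of_ne (by omega)]

lemma bddBelow_range_canonPhi {m : ℕ} {D : ℝ} (hD : ∀ x y : Ω, dist x y ≤ D) (bar : Ω → Ω)
    (Q : Finset (Sym2 (Fin (m + 1) × Fin m))) {w : (Fin (m + 1) → Ω) → ℝ}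
    (hw : ∀ X, 0 ≤ w X) (u : Ω) : BddBelow (Set.range (canonPhi bar Q w u)) := by
  refine ⟨-∑ _q ∈ Q, D, ?_⟩
  rintro _ ⟨x, rfl⟩
  have hsum : ∑ q ∈ Q, Sym2.lift
      ⟨fun a b => dist (x a.1 a.2) (x b.1 b.2), fun _ _ => dist_comm _ _⟩ q ≤ ∑ _q ∈ Q, D := by
    refine Finset.sum_le_sum fun q _ => ?_
    induction q with
    | _ a b => exact hD _ _
  have hpos : 0 ≤ ∑ i, w (Fin.cons u (x i)) := Finset.sum_nonneg fun _ _ => hw _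
  have := hw fun _ => bar u
  unfold canonPhi
  linarith

end WorkFunction

/-- If the potential values `Φ_t = inf_X Φ(w_t, r_t, X)` satisfy
`Φ_t − Φ_{t−1} ≥ w_t(r̄_t^k) − w_{t−1}(r̄_t^k)` on every instance, then restricting the
first argument of the canonical potential to the last request does not change the
infimum: `Φ_t = inf_{u,X} Φ(w_t, u, X)`. -/
theorem canonical_potential_restricted_to_request {Ω : Type*} [MetricSpace Ω]
    (Δ : ℝ) (bar : Ω → Ω) (hbar : ∀ x y : Ω, dist x y + dist y (bar x) = Δ)
    (m : ℕ) (Q : Finset (Sym2 (Fin (m + 1) × Fin m)))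
    (hyp : ∀ (X₀ : Fin (m + 1) → Ω) (r : ℕ → Ω) (T t : ℕ), 2 ≤ t → t ≤ T →
      (⨅ x : Fin (m + 1) → Fin m → Ω,
          canonPhi bar Q (workFn (m + 1) X₀ r t) (r t) x) -
        (⨅ x : Fin (m + 1) → Fin m → Ω,
          canonPhi bar Q (workFn (m + 1) X₀ r (t - 1)) (r (t - 1)) x) ≥
        workFn (m + 1) X₀ r t (fun _ => bar (r t)) -
          workFn (m + 1) X₀ r (t - 1) (fun _ => bar (r t))) :
    ∀ (X₀ : Fin (m + 1) → Ω) (r : ℕ → Ω) (T t : ℕ), 1 ≤ t → t ≤ T →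
      (⨅ x : Fin (m + 1) → Fin m → Ω,
          canonPhi bar Q (workFn (m + 1) X₀ r t) (r t) x) =
        ⨅ (u : Ω), ⨅ x : Fin (m + 1) → Fin m → Ω,
          canonPhi bar Q (workFn (m + 1) X₀ r t) u x := by
  intro X₀ r T t ht _
  have : Nonempty Ω := ⟨X₀ 0⟩
  have hD : ∀ x y : Ω, dist x y ≤ Δ := fun x y => by
    linarith [hbar x y, dist_nonneg (x := y) (y := bar x)]
  have key : ∀ u : Ω,
      (⨅ x : Fin (m + 1) → Fin m → Ω, canonPhi bar Q (workFn (m + 1) X₀ r t) (r t) x) ≤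
        ⨅ x : Fin (m + 1) → Fin m → Ω, canonPhi bar Q (workFn (m + 1) X₀ r t) u x := by
    intro u
    refine le_ciInf fun x => ?_
    set r' := Function.update r (t + 1) u
    have hu : r' (t + 1) = u := Function.update_self ..
    have hrt : r' t = r t := Function.update_of_ne (by omega) ..
    have hw : workFn (m + 1) X₀ r' t = workFn (m + 1) X₀ r t :=
      workFn_congr _ _ fun i hi => by
        have := Finset.mem_Icc.1 hi
        exact Function.update_of_ne (by omega) ..
    have hstep := hyp X₀ r' (t + 1) (t + 1) (by omega) le_rfl
    rw [Nat.add_sub_cancel, hu, hrt, hw] at hstep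
    have hinf := ciInf_le (bddBelow_range_canonPhi hD bar Q
      (workFn_nonneg (m + 1) X₀ r' (t + 1)) u) x
    have hsum : ∑ i, workFn (m + 1) X₀ r' (t + 1) (Fin.cons u (x i)) ≤
        ∑ i, workFn (m + 1) X₀ r t (Fin.cons u (x i)) := by
      refine Finset.sum_le_sum fun i _ => ?_
      rw [← hw]
      exact workFn_succ_le X₀ r' t _ ⟨0, by rw [hu, Fin.cons_zero]⟩
    have hphi : canonPhi bar Q (workFn (m + 1) X₀ r' (t + 1)) u x -
        workFn (m + 1) X₀ r' (t + 1) (fun _ => bar u) ≤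
        canonPhi bar Q (workFn (m + 1) X₀ r t) u x -
          workFn (m + 1) X₀ r t (fun _ => bar u) := by
      unfold canonPhi
      linarith
    linarith
  exact le_antisymm (le_ciInf key) (ciInf_le ⟨_, Set.forall_mem_range.2 key⟩ (r t))
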